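/- Fix a positive integer K, a set H, a colouring c assigning to every unordered pair of distinct elements of H a colour in {0,…,K−1}, fine normal ideals I ⊆ J on P_{ω1}(H), sets C, D ∈ J⁺, a function F : C ∪ D → H, and a set P ⊆ {0,…,K−1}×{0,…,K−1}. If (C,D) is P-unsaturated over J, then there exist S ⊆ C and T ⊆ D with S, T ∈ J⁺ such that (S,T) is P-unsaturated over I. -/

import Mathlib

namespace Galvin

/-- `P_{ω₁}(H)`: the collection of countable subsets of `H`. -/
def Pom (H : Type u) : Set (Set H) := {M : Set H | M.Countable}

/-- An ideal on `P_{ω₁}(H)`: a proper collection of subsets of `P_{ω₁}(H)` closed under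
subsets and finite unions. -/
structure IsIdeal (H : Type u) (I : Set (Set (Set H))) : Prop where
  subset_pom : ∀ A ∈ I, A ⊆ Pom H
  empty_mem : (∅ : Set (Set H)) ∈ I
  subset_mem : ∀ A ∈ I, ∀ B : Set (Set H), B ⊆ A → B ∈ I
  union_mem : ∀ A ∈ I, ∀ B ∈ I, A ∪ B ∈ I
  proper : Pom H ∉ I

/-- ℵ₁-completeness: closure under countable unions. -/
def IsComplete {H : Type u} (I : Set (Set (Set H))) : Prop :=
  ∀ A : ℕ → Set (Set H), (∀ n, A n ∈ I) → (⋃ n, A n) ∈ I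

/-- A fine ideal: an ℵ₁-complete ideal containing `{M : x ∉ M}` for every `x ∈ H`. -/
def IsFineIdeal (H : Type u) (I : Set (Set (Set H))) : Prop :=
  IsIdeal H I ∧ IsComplete I ∧ ∀ x : H, {M ∈ Pom H | x ∉ M} ∈ I

/-- Normality: closure under diagonal unions. -/
def IsNormal (H : Type u) (I : Set (Set (Set H))) : Prop :=
  ∀ A : H → Set (Set H), (∀ x, A x ∈ I) → {M ∈ Pom H | ∃ x ∈ M, M ∈ A x} ∈ I

/-- `I⁺`: the `I`-positive subsets of `P_{ω₁}(H)`. -/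
def pos (H : Type u) (I : Set (Set (Set H))) : Set (Set (Set H)) :=
  {A | A ⊆ Pom H ∧ A ∉ I}

/-- `I*`: the dual filter of `I`. -/
def star (H : Type u) (I : Set (Set (Set H))) : Set (Set (Set H)) :=
  {A | Pom H \ A ∈ I}

/-- `I + A`: the ideal `{B : B ∩ A ∈ I}`. -/
def add (H : Type u) (I : Set (Set (Set H))) (A : Set (Set H)) : Set (Set (Set H)) :=
  {B | B ⊆ Pom H ∧ B ∩ A ∈ I}

end Galvin
namespace Galvin

/-- `∃^I M ∈ A, φ(M)`: the set of `M ∈ A` with `φ(M)` is `(I+A)`-positive. -/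
def eIdeal {H : Type u} (I : Set (Set (Set H))) (A : Set (Set H)) (φ : Set H → Prop) : Prop :=
  {M ∈ A | φ M} ∈ pos H (add H I A)

/-- `∀^I M ∈ A, φ(M)`: the set of `M ∈ A` with `φ(M)` is in the dual filter `(I+A)*`. -/
def aIdeal {H : Type u} (I : Set (Set (Set H))) (A : Set (Set H)) (φ : Set H → Prop) : Prop :=
  {M ∈ A | φ M} ∈ star H (add H I A)

/-- `(A, B)` is weakly `(i,j)`-saturated over `I`. -/
def WeaklySat {H : Type u} {X : Type v} {K : ℕ} (c : Sym2 X → Fin K)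
    (I : Set (Set (Set H))) (F : Set H → X) (A B : Set (Set H)) (i j : Fin K) : Prop :=
  eIdeal I A (fun M => eIdeal I B (fun N => F M ≠ F N ∧ c s(F M, F N) = i)) ∧
  eIdeal I B (fun N => eIdeal I A (fun M => F M ≠ F N ∧ c s(F M, F N) = j))

/-- `(A, B)` is `(i,j)`-saturated over `I`: every pair of `I`-positive subsets is weakly
`(i,j)`-saturated over `I`. -/
def Sat {H : Type u} {X : Type v} {K : ℕ} (c : Sym2 X → Fin K)
    (I : Set (Set (Set H))) (F : Set H → X) (A B : Set (Set H)) (i j : Fin K) : Prop :=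
  ∀ C, C ⊆ A → C ∈ pos H I → ∀ D, D ⊆ B → D ∈ pos H I → WeaklySat c I F C D i j

/-- `(A, B)` is `P`-unsaturated over `I`: for no `(i,j) ∈ P` is `(A,B)` weakly
`(i,j)`-saturated over `I`. -/
def Unsat {H : Type u} {X : Type v} {K : ℕ} (c : Sym2 X → Fin K)
    (I : Set (Set (Set H))) (F : Set H → X) (A B : Set (Set H))
    (P : Set (Fin K × Fin K)) : Prop :=
  ∀ p ∈ P, ¬ WeaklySat c I F A B p.1 p.2

end Galvin

namespace Galvin

theorem IsIdeal.biUnion_mem {H : Type*} {ι : Type*} [Finite ι] {J : Set (Set (Set H))}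
    (hJ : IsIdeal H J) (Q : Set ι) (A : ι → Set (Set H)) (hA : ∀ i ∈ Q, A i ∈ J) :
    (⋃ i ∈ Q, A i) ∈ J := by
  induction Q, Q.toFinite using Set.Finite.induction_on with
  | empty => simpa using hJ.empty_mem
  | insert _ _ ih =>
    rw [Set.biUnion_insert]
    exact hJ.union_mem _ (hA _ (Set.mem_insert _ _)) _
      (ih fun i hi => hA i (Set.mem_insert_of_mem _ hi))

theorem eIdeal_iff {H : Type*} {J : Set (Set (Set H))} {A : Set (Set H)} (hA : A ⊆ Pom H)
    (φ : Set H → Prop) : eIdeal J A φ ↔ {M ∈ A | φ M} ∉ J := by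
  have hsub : {M ∈ A | φ M} ⊆ Pom H := fun M hM => hA hM.1
  have hinter : {M ∈ A | φ M} ∩ A = {M ∈ A | φ M} := Set.inter_eq_left.2 fun M hM => hM.1
  simp only [eIdeal, pos, add, Set.mem_ofPred_eq, hinter, hsub, true_and]

theorem not_eIdeal_of_forall_not {H : Type*} {I : Set (Set (Set H))} (hI : IsIdeal H I)
    {A : Set (Set H)} (hA : A ⊆ Pom H) {φ : Set H → Prop} (h : ∀ M ∈ A, ¬ φ M) :
    ¬ eIdeal I A φ := by
  rw [eIdeal_iff hA, not_not]
  exact hI.subset_mem _ hI.empty_mem _ fun M hM => h M hM.1 hM.2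

/-- If each of finitely many relations has null sections at almost every point, then so does
their union. -/
theorem IsIdeal.setOf_section_notMem_mem {H : Type*} {ι : Type*} [Finite ι]
    {J : Set (Set (Set H))} (hJ : IsIdeal H J) (C D : Set (Set H)) (Q : Set ι)
    (R : ι → Set H → Set H → Prop) (h : ∀ i ∈ Q, {M ∈ C | {N ∈ D | R i M N} ∉ J} ∈ J) :
    {M ∈ C | {N ∈ D | ∃ i ∈ Q, R i M N} ∉ J} ∈ J := by
  refine hJ.subset_mem _ (hJ.biUnion_mem Q _ h) _ ?_
  rintro M ⟨hM, hMJ⟩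
  by_contra hcon
  simp only [Set.mem_iUnion, Set.mem_ofPred_eq, not_exists, not_and, not_not] at hcon
  refine hMJ (hJ.subset_mem _ (hJ.biUnion_mem Q _ fun i hi => hcon i hi hM) _ ?_)
  rintro N ⟨hN, i, hi, hR⟩
  exact Set.mem_biUnion hi ⟨hN, hR⟩

/-- Normality, applied to sections along the values of `F`. -/
theorem IsNormal.setOf_exists_image_mem {H : Type*} {J : Set (Set (Set H))} (hJ : IsIdeal H J)
    (hJn : IsNormal H J) {C D : Set (Set H)} (hD : D ⊆ Pom H) (F : Set H → H)
    (G : H → Set H → Prop) (h : ∀ M ∈ C, {N ∈ D | G (F M) N} ∈ J) :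
    {N ∈ D | ∃ x ∈ N, x ∈ F '' C ∧ G x N} ∈ J := by
  refine hJ.subset_mem _ (hJn (fun x => {N ∈ D | x ∈ F '' C ∧ G x N}) fun x => ?_) _ ?_
  · by_cases hx : x ∈ F '' C
    · obtain ⟨M, hM, rfl⟩ := hx
      exact hJ.subset_mem _ (h M hM) _ fun N hN => ⟨hN.1, hN.2.2⟩
    · exact hJ.subset_mem _ hJ.empty_mem _ fun N hN => hx hN.2.1
  · rintro N ⟨hN, x, hxN, hx⟩
    exact ⟨hD hN, x, hxN, hN, hx⟩

theorem IsIdeal.sep_sdiff_mem_pos {H : Type*} {J : Set (Set (Set H))} (hJ : IsIdeal H J)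
    {C E : Set (Set H)} (hC : C ∈ pos H J) {p : Set H → Prop} (hp : {M ∈ C | ¬ p M} ∈ J)
    (hE : E ∈ J) : {M ∈ C | p M} \ E ∈ pos H J := by
  refine ⟨fun M hM => hC.1 hM.1.1, fun h => hC.2 ?_⟩
  refine hJ.subset_mem _ (hJ.union_mem _ h _ (hJ.union_mem _ hp _ hE)) _ fun M hM => ?_
  by_cases hpM : p M
  · by_cases hME : M ∈ E
    · exact Or.inr (Or.inr hME)
    · exact Or.inl ⟨⟨hM, hpM⟩, hME⟩
  · exact Or.inr (Or.inl ⟨hM, hpM⟩)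

/-- Lemma 6.6: for fine normal ideals `I ⊆ J`, if `(C, D)` is `P`-unsaturated over `J` then
there are `J`-positive `S ⊆ C` and `T ⊆ D` such that `(S, T)` is `P`-unsaturated over `I`. -/
theorem unsaturation_descends {H : Type u} (K : ℕ) (hK : 0 < K)
    (c : Sym2 H → Fin K) (I J : Set (Set (Set H)))
    (hI : IsFineIdeal H I) (hIn : IsNormal H I)
    (hJ : IsFineIdeal H J) (hJn : IsNormal H J) (hIJ : I ⊆ J)
    (C D : Set (Set H)) (hC : C ∈ pos H J) (hD : D ∈ pos H J)
    (F : Set H → H) (P : Set (Fin K × Fin K))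
    (hCD : Unsat c J F C D P) :
    ∃ S, S ⊆ C ∧ S ∈ pos H J ∧ ∃ T, T ⊆ D ∧ T ∈ pos H J ∧ Unsat c I F S T P := by
  have hJi := hJ.1
  set R : Fin K → Set H → Set H → Prop := fun i M N => F M ≠ F N ∧ c s(F M, F N) = i
  set Qa : Set (Fin K) := {i | {M ∈ C | {N ∈ D | R i M N} ∉ J} ∈ J}
  set Qb : Set (Fin K) := {j | {N ∈ D | {M ∈ C | R j M N} ∉ J} ∈ J}
  have hP : ∀ p ∈ P, p.1 ∈ Qa ∨ p.2 ∈ Qb := by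
    intro p hp
    have h := hCD p hp
    simp only [WeaklySat, eIdeal_iff hC.1, eIdeal_iff hD.1] at h
    by_contra! hcon
    exact h hcon
  have hC' := hJi.setOf_section_notMem_mem C D Qa R fun i hi => hi
  have hD' := hJi.setOf_section_notMem_mem D C Qb (fun j N M => R j M N) fun j hj => hj
  set C' : Set (Set H) := {M ∈ C | {N ∈ D | ∃ i ∈ Qa, R i M N} ∈ J}
  set D' : Set (Set H) := {N ∈ D | {M ∈ C | ∃ j ∈ Qb, R j M N} ∈ J}
  have hBD := hJn.setOf_exists_image_mem hJi (C := C') hD.1 F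
    (fun x N => ∃ i ∈ Qa, x ≠ F N ∧ c s(x, F N) = i) fun M hM => hM.2
  have hBC := hJn.setOf_exists_image_mem hJi (C := D') hC.1 F
    (fun y M => ∃ j ∈ Qb, F M ≠ y ∧ c s(F M, y) = j) fun N hN => hN.2
  have hS := hJi.sep_sdiff_mem_pos hC hC' hBC
  have hT := hJi.sep_sdiff_mem_pos hD hD' hBD
  refine ⟨_, fun M hM => hM.1.1, hS, _, fun N hN => hN.1.1, hT, fun p hp hW => ?_⟩
  rcases hP p hp with hi | hj
  · refine not_eIdeal_of_forall_not hI.1 hS.1 (fun M hM => ?_) hW.1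
    rw [eIdeal_iff hT.1, not_not]
    refine hI.1.subset_mem _ (hI.2.2 (F M)) _ ?_
    rintro N ⟨hN, hc⟩
    exact ⟨hT.1 hN, fun hFN => hN.2 ⟨hN.1.1, F M, hFN, ⟨M, hM.1, rfl⟩, p.1, hi, hc⟩⟩
  · refine not_eIdeal_of_forall_not hI.1 hT.1 (fun N hN => ?_) hW.2
    rw [eIdeal_iff hS.1, not_not]
    refine hI.1.subset_mem _ (hI.2.2 (F N)) _ ?_
    rintro M ⟨hM, hc⟩
    exact ⟨hS.1 hM, fun hFM => hM.2 ⟨hM.1.1, F N, hFM, ⟨N, hN.1, rfl⟩, p.2, hj, hc⟩⟩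

end Galvin
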